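/- Let e ∈ L \ {0,1}, T a t-norm on [0,e], and int an interior operator on L. Define U : L² → L by: U(x,y) = T(x,y) if (x,y) ∈ ]0,e]²; U(x,y) = x if (x,y) ∈ (I_e ∪ ]e,1]) × {e}; U(x,y) = y if (x,y) ∈ {e} × (I_e ∪ ]e,1]); U(x,y) = int(x) ∨ (x ∧ e) if (x,y) ∈ (I_e ∪ ]e,1[) × ]0,e[; U(x,y) = int(y) ∨ (y ∧ e) if (x,y) ∈ ]0,e[ × (I_e ∪ ]e,1[); U(x,y) = 0 if (x,y) ∈ L × {0} ∪ {0} × L; and U(x,y) = 1 otherwise. Then: (1) if int(x) ∉ [0,e] for all x ∈ I_e ∪ ]e,1[, then U is a uninorm on L with neutral element e if and only if 0 < T(x,y) for all x, y ∈ ]0,e[; (2) if ]0,e[ ≠ ∅, then U is a uninorm on L with neutral element e if and only if 0 < T(x,y) for all x, y ∈ ]0,e[ and int(x) ∉ [0,e] for all x ∈ I_e ∪ ]e,1[. -/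

import Mathlib

/-- `Par a b` means that `a` and `b` are incomparable. -/
def Par {L : Type*} [Lattice L] (a b : L) : Prop := ¬ a ≤ b ∧ ¬ b ≤ a

theorem par_or_mem_Ioc_top_iff {L : Type*} [Lattice L] [BoundedOrder L] {e x : L} :
    (Par x e ∨ x ∈ Set.Ioc e ⊤) ↔ ¬ x ≤ e := by
  constructor
  · rintro (h | h)
    · exact h.1
    · exact h.1.not_ge
  · intro h
    by_cases hx : e ≤ x
    · exact Or.inr ⟨lt_of_le_not_ge hx h, le_top⟩
    · exact Or.inl ⟨h, hx⟩

theorem par_or_mem_Ioo_top_iff {L : Type*} [Lattice L] [BoundedOrder L] {e x : L} :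
    (Par x e ∨ x ∈ Set.Ioo e ⊤) ↔ ¬ x ≤ e ∧ x ≠ ⊤ := by
  constructor
  · rintro (h | h)
    · refine ⟨h.1, ?_⟩
      rintro rfl
      exact h.2 le_top
    · exact ⟨h.1.not_ge, h.2.ne⟩
  · rintro ⟨h, hx⟩
    exact (par_or_mem_Ioc_top_iff.2 h).imp_right fun h' => ⟨h'.1, lt_top_iff_ne_top.2 hx⟩

theorem eq_bot_or_mem_Ioo_or_eq_or_not_le {L : Type*} [Lattice L] [BoundedOrder L] (e x : L) :
    x = ⊥ ∨ x ∈ Set.Ioo ⊥ e ∨ x = e ∨ (¬ x ≤ e ∧ x ≠ ⊤) ∨ x = ⊤ := by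
  by_cases h0 : x = ⊥
  · exact Or.inl h0
  by_cases hxe : x = e
  · exact Or.inr (Or.inr (Or.inl hxe))
  by_cases hx : x ≤ e
  · exact Or.inr (Or.inl ⟨bot_lt_iff_ne_bot.2 h0, lt_of_le_of_ne hx hxe⟩)
  · tauto

section InteriorJoin

variable {L : Type*} [Lattice L] {int : L → L}

theorem monotone_of_map_inf (hint_inf : ∀ x y, int (x ⊓ y) = int x ⊓ int y) : Monotone int := by
  intro x y hxy
  have h := hint_inf x y
  rw [inf_eq_left.2 hxy] at h
  exact inf_eq_left.1 h.symm

theorem interior_sup_inf_le (hint_le : ∀ x, int x ≤ x) (e x : L) : int x ⊔ (x ⊓ e) ≤ x :=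
  sup_le (hint_le x) inf_le_left

theorem interior_sup_inf_idem (hint_le : ∀ x, int x ≤ x)
    (hint_inf : ∀ x y, int (x ⊓ y) = int x ⊓ int y) (hint_idem : ∀ x, int (int x) = int x)
    (e x : L) :
    int (int x ⊔ (x ⊓ e)) ⊔ ((int x ⊔ (x ⊓ e)) ⊓ e) = int x ⊔ (x ⊓ e) := by
  refine le_antisymm (interior_sup_inf_le hint_le e _) (sup_le_sup ?_ ?_)
  · calc int x = int (int x) := (hint_idem x).symm
      _ ≤ int (int x ⊔ (x ⊓ e)) := monotone_of_map_inf hint_inf le_sup_left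
  · exact le_inf le_sup_right inf_le_right

end InteriorJoin

theorem uninorm_one_interior_bot_iff {L : Type*} [Lattice L] [BoundedOrder L]
    (e : L) (he0 : e ≠ ⊥) (he1 : e ≠ ⊤)
    (T : L → L → L)
    (hT_mem : ∀ x ∈ Set.Icc ⊥ e, ∀ y ∈ Set.Icc ⊥ e, T x y ∈ Set.Icc ⊥ e)
    (hT_comm : ∀ x ∈ Set.Icc ⊥ e, ∀ y ∈ Set.Icc ⊥ e, T x y = T y x)
    (hT_assoc : ∀ x ∈ Set.Icc ⊥ e, ∀ y ∈ Set.Icc ⊥ e, ∀ z ∈ Set.Icc ⊥ e, T (T x y) z = T x (T y z))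
    (hT_mono₁ : ∀ x ∈ Set.Icc ⊥ e, ∀ y ∈ Set.Icc ⊥ e, ∀ z ∈ Set.Icc ⊥ e, x ≤ y → T x z ≤ T y z)
    (hT_mono₂ : ∀ x ∈ Set.Icc ⊥ e, ∀ y ∈ Set.Icc ⊥ e, ∀ z ∈ Set.Icc ⊥ e, x ≤ y → T z x ≤ T z y)
    (hT_unit : ∀ x ∈ Set.Icc ⊥ e, T e x = x)
    (int : L → L)
    (hint_le : ∀ x, int x ≤ x)
    (hint_inf : ∀ x y, int (x ⊓ y) = int x ⊓ int y)
    (hint_idem : ∀ x, int (int x) = int x)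
    (U : L → L → L)
    (hU1 : ∀ x y, x ∈ Set.Ioc ⊥ e ∧ y ∈ Set.Ioc ⊥ e → U x y = T x y)
    (hU2 : ∀ x y, (Par x e ∨ x ∈ Set.Ioc e ⊤) ∧ y = e → U x y = x)
    (hU3 : ∀ x y, x = e ∧ (Par y e ∨ y ∈ Set.Ioc e ⊤) → U x y = y)
    (hU4 : ∀ x y, (Par x e ∨ x ∈ Set.Ioo e ⊤) ∧ y ∈ Set.Ioo ⊥ e → U x y = int x ⊔ (x ⊓ e))
    (hU5 : ∀ x y, x ∈ Set.Ioo ⊥ e ∧ (Par y e ∨ y ∈ Set.Ioo e ⊤) → U x y = int y ⊔ (y ⊓ e))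
    (hU6 : ∀ x y, x = ⊥ ∨ y = ⊥ → U x y = ⊥)
    (hU0 : ∀ x y, ¬(x ∈ Set.Ioc ⊥ e ∧ y ∈ Set.Ioc ⊥ e) → ¬((Par x e ∨ x ∈ Set.Ioc e ⊤) ∧ y = e) → ¬(x = e ∧ (Par y e ∨ y ∈ Set.Ioc e ⊤)) → ¬((Par x e ∨ x ∈ Set.Ioo e ⊤) ∧ y ∈ Set.Ioo ⊥ e) → ¬(x ∈ Set.Ioo ⊥ e ∧ (Par y e ∨ y ∈ Set.Ioo e ⊤)) → ¬(x = ⊥ ∨ y = ⊥) → U x y = ⊤)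
    :
    ((∀ x, (Par x e ∨ x ∈ Set.Ioo e ⊤) → int x ∉ Set.Icc ⊥ e) →
        (((∀ x y, U x y = U y x) ∧ (∀ x y z, U (U x y) z = U x (U y z)) ∧
      (∀ x y z, x ≤ y → U x z ≤ U y z) ∧ (∀ x y z, x ≤ y → U z x ≤ U z y) ∧
      (∀ x, U e x = x)) ↔ (∀ x ∈ Set.Ioo ⊥ e, ∀ y ∈ Set.Ioo ⊥ e, ⊥ < T x y))) ∧
    ((Set.Ioo ⊥ e).Nonempty →
        (((∀ x y, U x y = U y x) ∧ (∀ x y z, U (U x y) z = U x (U y z)) ∧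
      (∀ x y z, x ≤ y → U x z ≤ U y z) ∧ (∀ x y z, x ≤ y → U z x ≤ U z y) ∧
      (∀ x, U e x = x)) ↔ ((∀ x ∈ Set.Ioo ⊥ e, ∀ y ∈ Set.Ioo ⊥ e, ⊥ < T x y) ∧ (∀ x, (Par x e ∨ x ∈ Set.Ioo e ⊤) → int x ∉ Set.Icc ⊥ e)))) := by
  have memI : ∀ {x}, x ≤ e → x ∈ Set.Icc ⊥ e := fun h => ⟨bot_le, h⟩
  have he : e ∈ Set.Icc ⊥ e := memI le_rfl
  have e_pos : ⊥ < e := bot_lt_iff_ne_bot.2 he0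
  have top_not_le : ¬ ⊤ ≤ e := fun h => he1 (top_le_iff.1 h)
  simp only [par_or_mem_Ioc_top_iff, par_or_mem_Ioo_top_iff] at *
  have U_bot : ∀ x, U x ⊥ = ⊥ := fun x => hU6 _ _ (Or.inr rfl)
  have bot_U : ∀ x, U ⊥ x = ⊥ := fun x => hU6 _ _ (Or.inl rfl)
  have e_U : ∀ x, U e x = x := by
    intro x
    by_cases hx : x ≤ e
    · rcases eq_or_ne x ⊥ with rfl | h0
      · exact U_bot e
      · rw [hU1 e x ⟨⟨e_pos, le_rfl⟩, bot_lt_iff_ne_bot.2 h0, hx⟩, hT_unit x (memI hx)]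
    · exact hU3 e x ⟨rfl, hx⟩
  have U_e : ∀ x, U x e = x := by
    intro x
    by_cases hx : x ≤ e
    · rcases eq_or_ne x ⊥ with rfl | h0
      · exact bot_U e
      · rw [hU1 x e ⟨⟨bot_lt_iff_ne_bot.2 h0, hx⟩, e_pos, le_rfl⟩, hT_comm x (memI hx) e he,
          hT_unit x (memI hx)]
    · exact hU2 x e ⟨hx, rfl⟩
  have U_T : ∀ x ∈ Set.Ioo ⊥ e, ∀ y ∈ Set.Ioo ⊥ e, U x y = T x y := fun x hx y hy =>
    hU1 x y ⟨⟨hx.1, hx.2.le⟩, hy.1, hy.2.le⟩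
  have U_left : ∀ x y, ¬ x ≤ e ∧ x ≠ ⊤ → y ∈ Set.Ioo ⊥ e → U x y = int x ⊔ (x ⊓ e) :=
    fun x y hx hy => hU4 x y ⟨hx, hy⟩
  have U_right : ∀ x y, x ∈ Set.Ioo ⊥ e → ¬ y ≤ e ∧ y ≠ ⊤ → U x y = int y ⊔ (y ⊓ e) :=
    fun x y hx hy => hU5 x y ⟨hx, hy⟩
  have ne_bot : ∀ {x}, ¬ x ≤ e → x ≠ ⊥ := by
    rintro x hx rfl
    exact hx bot_le
  have U_big : ∀ x y, ¬ x ≤ e → ¬ y ≤ e → U x y = ⊤ := by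
    intro x y hx hy
    refine hU0 x y (fun h => hx h.1.2) ?_ ?_ (fun h => hy h.2.2.le) (fun h => hx h.1.2.le) ?_
    · rintro ⟨-, rfl⟩
      exact hy le_rfl
    · rintro ⟨rfl, -⟩
      exact hx le_rfl
    · rintro (h | h)
      · exact ne_bot hx h
      · exact ne_bot hy h
  have top_U : ∀ x, x ≠ ⊥ → U ⊤ x = ⊤ := by
    intro x h0
    by_cases hx : x ≤ e
    · rcases eq_or_lt_of_le hx with rfl | hlt
      · exact U_e ⊤
      · exact hU0 _ _ (fun h => top_not_le h.1.2) (fun h => hlt.ne h.2) (fun h => h.2 hx)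
          (fun h => h.1.2 rfl) (fun h => h.2.1 hx) (fun h => h.elim (ne_bot top_not_le) h0)
    · exact U_big _ _ top_not_le hx
  have U_top : ∀ x, x ≠ ⊥ → U x ⊤ = ⊤ := by
    intro x h0
    by_cases hx : x ≤ e
    · rcases eq_or_lt_of_le hx with rfl | hlt
      · exact e_U ⊤
      · exact hU0 _ _ (fun h => top_not_le h.2.2) (fun h => h.1 hx) (fun h => hlt.ne h.1)
          (fun h => h.1.1 hx) (fun h => h.2.2 rfl) (fun h => h.elim h0 (ne_bot top_not_le))
    · exact U_big _ _ hx top_not_le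
  have T_le_right : ∀ x ∈ Set.Ioo ⊥ e, ∀ y ∈ Set.Ioo ⊥ e, T x y ≤ y := by
    intro x hx y hy
    have h := hT_mono₁ x (memI hx.2.le) e he y (memI hy.2.le) hx.2.le
    rwa [hT_unit y (memI hy.2.le)] at h
  have pos_of_assoc : (∀ x y z, U (U x y) z = U x (U y z)) →
      ∀ x ∈ Set.Ioo ⊥ e, ∀ y ∈ Set.Ioo ⊥ e, ⊥ < T x y := by
    intro assoc x hx y hy
    refine bot_lt_iff_ne_bot.2 fun h => ?_
    have key := assoc x y ⊤
    rw [U_T x hx y hy, h, bot_U, U_top y hy.1.ne', U_top x hx.1.ne'] at key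
    exact ne_bot top_not_le key.symm
  have int_of_assoc : (Set.Ioo ⊥ e).Nonempty → (∀ x y z, U (U x y) z = U x (U y z)) →
      ∀ x, ¬ x ≤ e ∧ x ≠ ⊤ → int x ∉ Set.Icc ⊥ e := by
    rintro ⟨a, ha⟩ assoc x hx hint
    have key := assoc a x x
    rw [U_big x x hx.1 hx.1, U_top a ha.1.ne', U_right a x ha hx,
      sup_eq_right.2 (le_inf (hint_le x) hint.2)] at key
    rcases eq_or_ne (x ⊓ e) ⊥ with h0 | h0
    · rw [h0, bot_U] at key
      exact ne_bot top_not_le key.symm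
    rcases eq_or_lt_of_le (inf_le_right : x ⊓ e ≤ e) with h1 | h1
    · rw [h1, e_U] at key
      exact hx.2 key
    · rw [U_right _ x ⟨bot_lt_iff_ne_bot.2 h0, h1⟩ hx] at key
      exact hx.2 (top_le_iff.1 (key ▸ interior_sup_inf_le hint_le e x))
  have uninorm_of : (∀ x ∈ Set.Ioo ⊥ e, ∀ y ∈ Set.Ioo ⊥ e, ⊥ < T x y) →
      (∀ x, ¬ x ≤ e ∧ x ≠ ⊤ → int x ∉ Set.Icc ⊥ e) →
      (∀ x y, U x y = U y x) ∧ (∀ x y z, U (U x y) z = U x (U y z)) ∧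
      (∀ x y z, x ≤ y → U x z ≤ U y z) ∧ (∀ x y z, x ≤ y → U z x ≤ U z y) ∧
      (∀ x, U e x = x) := by
    intro hpos hint
    have T_mem : ∀ x ∈ Set.Ioo ⊥ e, ∀ y ∈ Set.Ioo ⊥ e, T x y ∈ Set.Ioo ⊥ e := fun x hx y hy =>
      ⟨hpos x hx y hy, (T_le_right x hx y hy).trans_lt hy.2⟩
    have join_mem : ∀ x, ¬ x ≤ e ∧ x ≠ ⊤ →
        ¬ int x ⊔ (x ⊓ e) ≤ e ∧ int x ⊔ (x ⊓ e) ≠ ⊤ := fun x hx =>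
      ⟨fun h => hint x hx (memI (le_sup_left.trans h)),
        fun h => hx.2 (top_le_iff.1 (h ▸ interior_sup_inf_le hint_le e x))⟩
    have idem := interior_sup_inf_idem hint_le hint_inf hint_idem e
    have U_ne_bot : ∀ x y, x ≠ ⊥ → y ≠ ⊥ → U x y ≠ ⊥ := by
      intro x y hx0 hy0
      rcases eq_bot_or_mem_Ioo_or_eq_or_not_le e x with h | hx | rfl | hx | rfl
      · exact absurd h hx0
      · rcases eq_bot_or_mem_Ioo_or_eq_or_not_le e y with h | hy | rfl | hy | rfl
        · exact absurd h hy0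
        · rw [U_T x hx y hy]; exact (hpos x hx y hy).ne'
        · rwa [U_e]
        · rw [U_right x y hx hy]; exact ne_bot (join_mem y hy).1
        · rwa [U_top x hx0]
      · rwa [e_U]
      · by_cases hy : y ≤ e
        · rcases eq_or_lt_of_le hy with rfl | hlt
          · rwa [U_e]
          · rw [U_left x y hx ⟨bot_lt_iff_ne_bot.2 hy0, hlt⟩]
            exact ne_bot (join_mem x hx).1
        · rw [U_big x y hx.1 hy]; exact ne_bot top_not_le
      · rwa [top_U y hy0]
    have comm : ∀ x y, U x y = U y x := by
      intro x y
      rcases eq_bot_or_mem_Ioo_or_eq_or_not_le e x with rfl | hx | rfl | hx | rfl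
      · rw [bot_U, U_bot]
      · rcases eq_bot_or_mem_Ioo_or_eq_or_not_le e y with rfl | hy | rfl | hy | rfl
        · rw [bot_U, U_bot]
        · rw [U_T x hx y hy, U_T y hy x hx, hT_comm x (memI hx.2.le) y (memI hy.2.le)]
        · rw [e_U, U_e]
        · rw [U_right x y hx hy, U_left y x hy hx]
        · rw [U_top x hx.1.ne', top_U x hx.1.ne']
      · rw [e_U, U_e]
      · rcases eq_bot_or_mem_Ioo_or_eq_or_not_le e y with rfl | hy | rfl | hy | rfl
        · rw [bot_U, U_bot]
        · rw [U_left x y hx hy, U_right y x hy hx]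
        · rw [e_U, U_e]
        · rw [U_big x y hx.1 hy.1, U_big y x hy.1 hx.1]
        · rw [U_big x ⊤ hx.1 top_not_le, U_big ⊤ x top_not_le hx.1]
      · rcases eq_or_ne y ⊥ with rfl | hy
        · rw [bot_U, U_bot]
        · rw [U_top y hy, top_U y hy]
    have mono : ∀ x y z, x ≤ y → U x z ≤ U y z := by
      intro x y z hxy
      rcases eq_or_ne x ⊥ with rfl | hx0
      · rw [bot_U]; exact bot_le
      have hy0 : y ≠ ⊥ := fun h => hx0 (le_bot_iff.1 (h ▸ hxy))
      rcases eq_or_ne y ⊤ with rfl | hy1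
      · rcases eq_or_ne z ⊥ with rfl | hz
        · rw [U_bot, U_bot]
        · rw [top_U z hz]; exact le_top
      rcases eq_bot_or_mem_Ioo_or_eq_or_not_le e z with rfl | hz | rfl | hz | rfl
      · rw [U_bot, U_bot]
      · by_cases hx : x ≤ e
        · have hxz : U x z ≤ x ∧ U x z ≤ z := by
            rcases eq_or_lt_of_le hx with rfl | hlt
            · rw [e_U]; exact ⟨hz.2.le, le_rfl⟩
            · have hx' : x ∈ Set.Ioo ⊥ e := ⟨bot_lt_iff_ne_bot.2 hx0, hlt⟩
              rw [U_T x hx' z hz]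
              refine ⟨?_, T_le_right x hx' z hz⟩
              rw [hT_comm x (memI hx) z (memI hz.2.le)]
              exact T_le_right z hz x hx'
          by_cases hy : y ≤ e
          · rw [hU1 x z ⟨⟨bot_lt_iff_ne_bot.2 hx0, hx⟩, hz.1, hz.2.le⟩,
              hU1 y z ⟨⟨bot_lt_iff_ne_bot.2 hy0, hy⟩, hz.1, hz.2.le⟩]
            exact hT_mono₁ x (memI hx) y (memI hy) z (memI hz.2.le) hxy
          · rw [U_left y z ⟨hy, hy1⟩ hz]
            exact (le_inf (hxz.1.trans hxy) (hxz.2.trans hz.2.le)).trans le_sup_right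
        · have hx1 : x ≠ ⊤ := fun h => hy1 (top_le_iff.1 (h ▸ hxy))
          rw [U_left x z ⟨hx, hx1⟩ hz, U_left y z ⟨fun h => hx (hxy.trans h), hy1⟩ hz]
          exact sup_le_sup (monotone_of_map_inf hint_inf hxy) (inf_le_inf_right e hxy)
      · rwa [U_e, U_e]
      · by_cases hy : y ≤ e
        · rcases eq_or_lt_of_le hy with rfl | hlt
          · rw [e_U]
            rcases eq_or_lt_of_le hxy with rfl | hlt
            · rw [e_U]
            · rw [U_right x z ⟨bot_lt_iff_ne_bot.2 hx0, hlt⟩ hz]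
              exact interior_sup_inf_le hint_le _ z
          · rw [U_right x z ⟨bot_lt_iff_ne_bot.2 hx0, hxy.trans_lt hlt⟩ hz,
              U_right y z ⟨bot_lt_iff_ne_bot.2 hy0, hlt⟩ hz]
        · rw [U_big y z hy hz.1]; exact le_top
      · rw [U_top y hy0]; exact le_top
    have assoc : ∀ x y z, U (U x y) z = U x (U y z) := by
      intro x y z
      rcases eq_or_ne x ⊥ with rfl | hx0
      · simp only [bot_U]
      rcases eq_or_ne y ⊥ with rfl | hy0
      · simp only [bot_U, U_bot]
      rcases eq_or_ne z ⊥ with rfl | hz0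
      · simp only [U_bot]
      have hxy0 := U_ne_bot x y hx0 hy0
      have hyz0 := U_ne_bot y z hy0 hz0
      rcases eq_bot_or_mem_Ioo_or_eq_or_not_le e x with h | hx | rfl | hx | rfl
      · exact absurd h hx0
      · rcases eq_bot_or_mem_Ioo_or_eq_or_not_le e y with h | hy | rfl | hy | rfl
        · exact absurd h hy0
        · rcases eq_bot_or_mem_Ioo_or_eq_or_not_le e z with h | hz | rfl | hz | rfl
          · exact absurd h hz0
          · rw [U_T x hx y hy, U_T y hy z hz, U_T _ (T_mem x hx y hy) z hz,
              U_T x hx _ (T_mem y hy z hz),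
              hT_assoc x (memI hx.2.le) y (memI hy.2.le) z (memI hz.2.le)]
          · rw [U_e, U_e]
          · rw [U_T x hx y hy, U_right _ z (T_mem x hx y hy) hz, U_right y z hy hz,
              U_right x _ hx (join_mem z hz), idem]
          · rw [U_top _ hxy0, U_top y hy0, U_top x hx0]
        · rw [U_e, e_U]
        · rcases eq_bot_or_mem_Ioo_or_eq_or_not_le e z with h | hz | rfl | hz | rfl
          · exact absurd h hz0
          · rw [U_right x y hx hy, U_left y z hy hz, U_left _ z (join_mem y hy) hz,
              U_right x _ hx (join_mem y hy)]
          · rw [U_e, U_e]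
          · rw [U_right x y hx hy, U_big _ z (join_mem y hy).1 hz.1, U_big y z hy.1 hz.1,
              U_top x hx0]
          · rw [U_top _ hxy0, U_top y hy0, U_top x hx0]
        · rw [U_top x hx0, top_U z hz0, U_top x hx0]
      · rw [e_U, e_U]
      · rcases eq_bot_or_mem_Ioo_or_eq_or_not_le e y with h | hy | rfl | hy | rfl
        · exact absurd h hy0
        · rcases eq_bot_or_mem_Ioo_or_eq_or_not_le e z with h | hz | rfl | hz | rfl
          · exact absurd h hz0
          · rw [U_left x y hx hy, U_T y hy z hz, U_left _ z (join_mem x hx) hz,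
              U_left x _ hx (T_mem y hy z hz), idem]
          · rw [U_e, U_e]
          · rw [U_left x y hx hy, U_right y z hy hz, U_big _ z (join_mem x hx).1 hz.1,
              U_big x _ hx.1 (join_mem z hz).1]
          · rw [U_top _ hxy0, U_top y hy0, U_top x hx0]
        · rw [U_e, e_U]
        · rw [U_big x y hx.1 hy.1, top_U z hz0]
          rcases eq_bot_or_mem_Ioo_or_eq_or_not_le e z with h | hz | rfl | hz | rfl
          · exact absurd h hz0
          · rw [U_left y z hy hz, U_big x _ hx.1 (join_mem y hy).1]
          · rw [U_e, U_big x y hx.1 hy.1]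
          · rw [U_big y z hy.1 hz.1, U_top x hx0]
          · rw [U_top y hy0, U_top x hx0]
        · rw [U_top x hx0, top_U z hz0, U_top x hx0]
      · rw [top_U y hy0, top_U z hz0, top_U _ hyz0]
    refine ⟨comm, assoc, mono, fun x y z hxy => ?_, e_U⟩
    rw [comm z x, comm z y]
    exact mono x y z hxy
  refine ⟨fun hint => ⟨fun h => pos_of_assoc h.2.1, fun hpos => uninorm_of hpos hint⟩,
    fun hne => ⟨fun h => ⟨pos_of_assoc h.2.1, int_of_assoc hne h.2.1⟩,
      fun h => uninorm_of h.1 h.2⟩⟩
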